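/- arXiv:1507.08706 — 2 statements merged into one kernel-verified Lean document; each statement's English description precedes it below -/
import Mathlib

section
/- Let q₀, h₀, D∞, σ, l, ρ, c be positive constants and ε ∈ (0,1). Then there exist γ > 0 and k > 0 satisfying, with α = k/(ρc), the system (E1): q₀/(ρ l) = [σ + (γ k (1−ε)/(2q₀))·exp(σ²/α)]·exp(σ²/α) and (E2): erf(σ/√α) = (k D∞/(q₀√(απ)))(1 − q₀/(h₀ D∞)), if and only if the following three conditions hold: (R2) 0 < 1 − q₀/(h₀D∞); (R3) q₀/(ρ l σ) > 1; and (R4) 1 − q₀/(h₀D∞) < (q₀√π/(σ ρ c D∞))·g₄(√(ln(q₀/(ρ l σ)))), where g₄(x) = x·erf(x). In that case the solution is unique and is given by k = ρc(σ/ξ)² and γ = (2q₀/(σρc(1−ε)))·((q₀/(ρlσ))·exp(−ξ²) − 1)·ξ²·exp(−ξ²), where ξ is the unique positive solution of ξ·erf(ξ) = (σρcD∞/(q₀√π))(1 − q₀/(h₀D∞)). -/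
open Real Set

/-- The Gauss error function `erf z = (2/√π) ∫₀ᶻ exp(−s²) ds`. -/
noncomputable def erf (z : ℝ) : ℝ := 2 / Real.sqrt π * ∫ s in (0:ℝ)..z, Real.exp (-s ^ 2)

/-- Equation (E1) of the paper, with `α = k/(ρc)`:
`q₀/(ρl) = [σ + (γk(1−ε)/(2q₀))·exp(σ²/α)]·exp(σ²/α)`. -/
def eqE1 (q₀ σ l k ρ c γ ε : ℝ) : Prop :=
  q₀ / (ρ * l) =
    (σ + γ * k * (1 - ε) / (2 * q₀) * Real.exp (σ ^ 2 / (k / (ρ * c)))) *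
      Real.exp (σ ^ 2 / (k / (ρ * c)))

/-- Equation (E2) of the paper, with `α = k/(ρc)`:
`erf(σ/√α) = (kD∞/(q₀√(απ)))(1 − q₀/(h₀D∞))`. -/
def eqE2 (q₀ h₀ D σ k ρ c : ℝ) : Prop :=
  erf (σ / Real.sqrt (k / (ρ * c))) =
    k * D / (q₀ * Real.sqrt (k / (ρ * c) * π)) * (1 - q₀ / (h₀ * D))

theorem erf_zero : erf 0 = 0 := by simp [erf]

theorem intervalIntegrable_exp_neg_sq (a b : ℝ) :
    IntervalIntegrable (fun s : ℝ => Real.exp (-s ^ 2)) MeasureTheory.volume a b :=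
  Continuous.intervalIntegrable (by fun_prop) a b

theorem continuous_erf : Continuous erf :=
  continuous_const.mul (intervalIntegral.continuous_primitive intervalIntegrable_exp_neg_sq 0)

theorem strictMono_erf : StrictMono erf := by
  intro a b hab
  have hpos : 0 < ∫ s in a..b, Real.exp (-s ^ 2) :=
    intervalIntegral.intervalIntegral_pos_of_pos (intervalIntegrable_exp_neg_sq a b)
      (fun _ => Real.exp_pos _) hab
  have hadd := intervalIntegral.integral_add_adjacent_intervals
    (intervalIntegrable_exp_neg_sq 0 a) (intervalIntegrable_exp_neg_sq a b)
  exact mul_lt_mul_of_pos_left (by linarith) (by positivity)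

theorem erf_pos {x : ℝ} (hx : 0 < x) : 0 < erf x := by
  simpa [erf_zero] using strictMono_erf hx

theorem strictMonoOn_mul_erf : StrictMonoOn (fun x => x * erf x) (Ici 0) := by
  intro a ha b _ hab
  have hb : 0 < b := lt_of_le_of_lt ha hab
  have ha' : 0 ≤ erf a := by simpa [erf_zero] using strictMono_erf.monotone ha
  exact mul_lt_mul'' hab (strictMono_erf hab) ha ha'

theorem exists_similarity_parameter {σ ρ c k : ℝ} (hσ : 0 < σ) (hρ : 0 < ρ) (hc : 0 < c)
    (hk : 0 < k) : ∃ x : ℝ, 0 < x ∧ k = ρ * c * (σ / x) ^ 2 := by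
  refine ⟨σ / √(k / (ρ * c)), by positivity, ?_⟩
  rw [div_div_cancel₀ hσ.ne', Real.sq_sqrt (by positivity)]
  field_simp

theorem eqE1_iff_of_similarity {q₀ σ l ρ c γ ε x : ℝ} (hq : 0 < q₀) (hσ : 0 < σ) (hl : 0 < l)
    (hρ : 0 < ρ) (hc : 0 < c) (hε : ε < 1) (hx : 0 < x) :
    eqE1 q₀ σ l (ρ * c * (σ / x) ^ 2) ρ c γ ε ↔
      γ = 2 * q₀ / (σ * ρ * c * (1 - ε)) *
        (q₀ / (ρ * l * σ) * Real.exp (-x ^ 2) - 1) * x ^ 2 * Real.exp (-x ^ 2) := by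
  have hε' : 1 - ε ≠ 0 := (sub_pos.2 hε).ne'
  have hexp : σ ^ 2 / (ρ * c * (σ / x) ^ 2 / (ρ * c)) = x ^ 2 := by field_simp
  have he : Real.exp (x ^ 2) ≠ 0 := (Real.exp_pos _).ne'
  rw [eqE1, hexp, Real.exp_neg]
  generalize Real.exp (x ^ 2) = E at he ⊢
  field_simp
  constructor <;> intro h <;> linarith

theorem eqE2_iff_of_similarity {q₀ h₀ D σ ρ c x : ℝ} (hq : 0 < q₀) (hσ : 0 < σ)
    (hρ : 0 < ρ) (hc : 0 < c) (hx : 0 < x) :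
    eqE2 q₀ h₀ D σ (ρ * c * (σ / x) ^ 2) ρ c ↔
      x * erf x = σ * ρ * c * D / (q₀ * √π) * (1 - q₀ / (h₀ * D)) := by
  have hα : ρ * c * (σ / x) ^ 2 / (ρ * c) = (σ / x) ^ 2 := by field_simp
  have hπ : √π ≠ 0 := (Real.sqrt_pos.2 Real.pi_pos).ne'
  rw [eqE2, hα, Real.sqrt_mul (by positivity), Real.sqrt_sq (by positivity),
    div_div_cancel₀ hσ.ne']
  generalize 1 - q₀ / (h₀ * D) = δ
  generalize √π = p at hπ ⊢
  field_simp

theorem one_lt_mul_exp_neg_sq_iff {A x : ℝ} (hA : 0 < A) (hx : 0 < x) :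
    1 < A * Real.exp (-x ^ 2) ↔ x < √(Real.log A) := by
  rw [Real.lt_sqrt hx.le, Real.lt_log_iff_exp_lt hA, Real.exp_neg, ← div_eq_mul_inv,
    one_lt_div (Real.exp_pos _)]

/-- Case 7 (determination of `γ` and `k`): there exist `γ > 0` and `k > 0` satisfying the
system (E1)–(E2) iff (R2) `0 < 1 − q₀/(h₀D∞)`, (R3) `q₀/(ρlσ) > 1` and (R4)
`1 − q₀/(h₀D∞) < (q₀√π/(σρcD∞))·g₄(√(ln(q₀/(ρlσ))))` hold; in that case the solution is
unique and given by `k = ρc(σ/ξ)²` and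
`γ = (2q₀/(σρc(1−ε)))·((q₀/(ρlσ))·exp(−ξ²) − 1)·ξ²·exp(−ξ²)`, where `ξ` is the unique
positive solution of `ξ·erf(ξ) = (σρcD∞/(q₀√π))(1 − q₀/(h₀D∞))`. -/
theorem case7_gamma_k (q₀ h₀ D σ l ρ c ε : ℝ)
    (hq : 0 < q₀) (hh : 0 < h₀) (hD : 0 < D) (hσ : 0 < σ) (hl : 0 < l)
    (hρ : 0 < ρ) (hc : 0 < c) (hε : ε ∈ Set.Ioo (0:ℝ) 1) :
    ((∃ γ k : ℝ, 0 < γ ∧ 0 < k ∧ eqE1 q₀ σ l k ρ c γ ε ∧ eqE2 q₀ h₀ D σ k ρ c)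
      ↔ (0 < 1 - q₀ / (h₀ * D) ∧ 1 < q₀ / (ρ * l * σ) ∧
         1 - q₀ / (h₀ * D) <
           q₀ * Real.sqrt π / (σ * ρ * c * D) *
             (Real.sqrt (Real.log (q₀ / (ρ * l * σ))) *
               erf (Real.sqrt (Real.log (q₀ / (ρ * l * σ))))))) ∧
    ((0 < 1 - q₀ / (h₀ * D) ∧ 1 < q₀ / (ρ * l * σ) ∧
        1 - q₀ / (h₀ * D) <
          q₀ * Real.sqrt π / (σ * ρ * c * D) *
            (Real.sqrt (Real.log (q₀ / (ρ * l * σ))) *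
              erf (Real.sqrt (Real.log (q₀ / (ρ * l * σ)))))) →
      ∀ ξ : ℝ, 0 < ξ →
        ξ * erf ξ = σ * ρ * c * D / (q₀ * Real.sqrt π) * (1 - q₀ / (h₀ * D)) →
        ∀ γ k : ℝ, 0 < γ → 0 < k →
          ((eqE1 q₀ σ l k ρ c γ ε ∧ eqE2 q₀ h₀ D σ k ρ c) ↔
            (k = ρ * c * (σ / ξ) ^ 2 ∧
             γ = 2 * q₀ / (σ * ρ * c * (1 - ε)) *
                   (q₀ / (ρ * l * σ) * Real.exp (-ξ ^ 2) - 1) * ξ ^ 2 *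
                     Real.exp (-ξ ^ 2)))) := by
  have hA : 0 < q₀ / (ρ * l * σ) := by positivity
  have hε' : 0 < 1 - ε := sub_pos.2 hε.2
  have hπ : 0 < √π := Real.sqrt_pos.2 Real.pi_pos
  have hK : 0 < σ * ρ * c * D / (q₀ * √π) := by positivity
  have hinv : q₀ * √π / (σ * ρ * c * D) = (σ * ρ * c * D / (q₀ * √π))⁻¹ := (inv_div _ _).symm
  refine ⟨⟨?_, ?_⟩, ?_⟩
  · rintro ⟨γ, k, hγ, hk, h1, h2⟩
    obtain ⟨x, hx, rfl⟩ := exists_similarity_parameter hσ hρ hc hk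
    rw [eqE1_iff_of_similarity hq hσ hl hρ hc hε.2 hx] at h1
    rw [eqE2_iff_of_similarity hq hσ hρ hc hx] at h2
    have hAx : 1 < q₀ / (ρ * l * σ) * Real.exp (-x ^ 2) := by
      rw [h1] at hγ
      have h3 := pos_of_mul_pos_left hγ (Real.exp_pos _).le
      have h4 := pos_of_mul_pos_left h3 (sq_nonneg x)
      have h5 := pos_of_mul_pos_right h4 (by positivity)
      linarith
    have hlt := (one_lt_mul_exp_neg_sq_iff hA hx).1 hAx
    refine ⟨?_, ?_, ?_⟩
    · exact pos_of_mul_pos_right (h2 ▸ mul_pos hx (erf_pos hx)) hK.le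
    · have hlog : 0 < Real.log (q₀ / (ρ * l * σ)) := Real.sqrt_pos.1 (hx.trans hlt)
      exact (Real.log_pos_iff hA.le).1 hlog
    · rw [hinv, lt_inv_mul_iff₀ hK, ← h2]
      exact strictMonoOn_mul_erf hx.le (Real.sqrt_nonneg _) hlt
  · rintro ⟨hR2, -, hR4⟩
    rw [hinv, lt_inv_mul_iff₀ hK] at hR4
    have hcont : ContinuousOn (fun x => x * erf x)
        (Icc 0 (√(Real.log (q₀ / (ρ * l * σ))))) :=
      (continuous_id.mul continuous_erf).continuousOn
    obtain ⟨x, ⟨hx, hlt⟩, h2⟩ := intermediate_value_Ioo (Real.sqrt_nonneg _) hcont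
      ⟨by simpa using mul_pos hK hR2, hR4⟩
    have hAx := (one_lt_mul_exp_neg_sq_iff hA hx).2 hlt
    refine ⟨_, ρ * c * (σ / x) ^ 2, ?_, by positivity,
      (eqE1_iff_of_similarity hq hσ hl hρ hc hε.2 hx).2 rfl,
      (eqE2_iff_of_similarity hq hσ hρ hc hx).2 h2⟩
    have h3 := sub_pos.2 hAx
    positivity
  · rintro - ξ hξ hξeq γ k - hk
    constructor
    · rintro ⟨h1, h2⟩
      obtain ⟨x, hx, rfl⟩ := exists_similarity_parameter hσ hρ hc hk
      rw [eqE2_iff_of_similarity hq hσ hρ hc hx, ← hξeq] at h2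
      obtain rfl := strictMonoOn_mul_erf.injOn hx.le hξ.le h2
      exact ⟨rfl, (eqE1_iff_of_similarity hq hσ hl hρ hc hε.2 hx).1 h1⟩
    · rintro ⟨rfl, h1⟩
      exact ⟨(eqE1_iff_of_similarity hq hσ hl hρ hc hε.2 hξ).2 h1,
        (eqE2_iff_of_similarity hq hσ hρ hc hξ).2 hξeq⟩
end

section
/- Let q₀, h₀, D∞, σ, k, l, γ be positive constants and ε ∈ (0,1). Then there exist ρ > 0 and c > 0 satisfying, with α = k/(ρc), the system (E1): q₀/(ρ l) = [σ + (γ k (1−ε)/(2q₀))·exp(σ²/α)]·exp(σ²/α) and (E2): erf(σ/√α) = (k D∞/(q₀√(απ)))(1 − q₀/(h₀ D∞)), if and only if 0 < 1 − q₀/(h₀D∞) < 2q₀σ/(k D∞) (conditions (R2) and (R17)). In that case the solution is unique and is given by ρ = (q₀/(lσ))·exp(−ξ²)/(1 + (γk(1−ε)/(2q₀σ))·exp(ξ²)) and c = (kl/(σq₀))·[1 + (γk(1−ε)/(2q₀σ))·exp(ξ²)]·ξ²·exp(ξ²), where ξ is the unique positive solution of erf(ξ)/ξ = (kD∞/(q₀σ√π))(1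 − q₀/(h₀D∞)). -/
open Real Set

/-- The mean of `s ↦ exp (-s ^ 2)` over `[0, x]`, rescaled to the unit interval. -/
noncomputable def gaussianMean (x : ℝ) : ℝ := ∫ t in (0:ℝ)..1, Real.exp (-(x * t) ^ 2)

theorem erf_div_self {x : ℝ} (hx : x ≠ 0) :
    erf x / x = 2 / Real.sqrt π * gaussianMean x := by
  have h := intervalIntegral.integral_comp_mul_left (a := 0) (b := 1)
    (fun s : ℝ => Real.exp (-s ^ 2)) hx
  simp only [mul_zero, mul_one, smul_eq_mul] at h
  rw [erf, gaussianMean, h]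
  field_simp

theorem continuous_gaussianMean : Continuous gaussianMean :=
  intervalIntegral.continuous_parametric_intervalIntegral_of_continuous' (by fun_prop) 0 1

theorem gaussianMean_zero : gaussianMean 0 = 1 := by simp [gaussianMean]

theorem strictAntiOn_gaussianMean : StrictAntiOn gaussianMean (Ici 0) := by
  intro x hx y hy hxy
  have hx : 0 ≤ x := hx
  refine intervalIntegral.integral_lt_integral_of_continuousOn_of_le_of_exists_lt one_pos
    (by fun_prop) (by fun_prop) (fun t ht => ?_) ⟨1, by simp, ?_⟩
  · have := ht.1.le
    gcongr
  · gcongr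

theorem gaussianMean_pos (x : ℝ) : 0 < gaussianMean x :=
  intervalIntegral.intervalIntegral_pos_of_pos
    (Continuous.intervalIntegrable (by fun_prop) 0 1) (fun _ => Real.exp_pos _) one_pos

theorem gaussianMean_le {x : ℝ} (hx : 0 < x) : gaussianMean x ≤ x⁻¹ * (π / 2) := by
  have h := intervalIntegral.integral_comp_mul_left (a := 0) (b := 1)
    (fun s : ℝ => Real.exp (-s ^ 2)) hx.ne'
  simp only [mul_zero, mul_one, smul_eq_mul] at h
  rw [gaussianMean, h]
  gcongr
  calc ∫ s in (0:ℝ)..x, Real.exp (-s ^ 2) ≤ ∫ s in (0:ℝ)..x, (1 + s ^ 2)⁻¹ := by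
        refine intervalIntegral.integral_mono_on hx.le
          (Continuous.intervalIntegrable (by fun_prop) 0 x) ?_ fun s _ => ?_
        · exact Continuous.intervalIntegrable
            (Continuous.inv₀ (by fun_prop) fun s => by positivity) 0 x
        · rw [Real.exp_neg]
          gcongr
          linarith [Real.add_one_le_exp (s ^ 2)]
    _ ≤ π / 2 := by
        simpa using (Real.arctan_lt_pi_div_two x).le

theorem exists_gaussianMean_eq_iff {v : ℝ} :
    (∃ x, 0 < x ∧ gaussianMean x = v) ↔ 0 < v ∧ v < 1 := by
  constructor
  · rintro ⟨x, hx, rfl⟩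
    exact ⟨gaussianMean_pos x, gaussianMean_zero ▸
      strictAntiOn_gaussianMean self_mem_Ici hx.le hx⟩
  · rintro ⟨h0, h1⟩
    have hX : 0 < π / 2 / v := by positivity
    have hle : gaussianMean (π / 2 / v) ≤ v := by
      refine (gaussianMean_le hX).trans_eq ?_
      field_simp
    obtain ⟨x, hx, hxv⟩ := intermediate_value_Icc' hX.le
      continuous_gaussianMean.continuousOn ⟨hle, gaussianMean_zero ▸ h1.le⟩
    refine ⟨x, hx.1.lt_of_ne ?_, hxv⟩
    rintro rfl
    exact h1.ne (hxv.symm.trans gaussianMean_zero)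

theorem erf_div_self_inj {x y : ℝ} (hx : 0 < x) (hy : 0 < y) :
    erf x / x = erf y / y ↔ x = y := by
  rw [erf_div_self hx.ne', erf_div_self hy.ne', mul_right_inj' (by positivity)]
  exact strictAntiOn_gaussianMean.injOn.eq_iff hx.le hy.le

theorem exists_erf_div_self_eq_iff {v : ℝ} :
    (∃ x, 0 < x ∧ erf x / x = v) ↔ 0 < v ∧ v < 2 / Real.sqrt π := by
  have hc : 0 < 2 / Real.sqrt π := by positivity
  have key : (∃ x, 0 < x ∧ erf x / x = v) ↔
      ∃ x, 0 < x ∧ gaussianMean x = v / (2 / Real.sqrt π) := by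
    refine exists_congr fun x => and_congr_right fun hx => ?_
    rw [erf_div_self hx.ne', eq_div_iff hc.ne', mul_comm]
  rw [key, exists_gaussianMean_eq_iff, div_pos_iff_of_pos_right hc, div_lt_one hc]

/-- The similarity parameter `σ / √α` with `α = k / (ρ c)`. -/
noncomputable def similarityParam (σ k ρ c : ℝ) : ℝ := σ / Real.sqrt (k / (ρ * c))

section

variable {q₀ h₀ D σ k l γ ε ρ c : ℝ}

theorem similarityParam_pos (hσ : 0 < σ) (hk : 0 < k) (hρ : 0 < ρ) (hc : 0 < c) :
    0 < similarityParam σ k ρ c := by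
  unfold similarityParam
  positivity

theorem similarityParam_sq (hk : 0 < k) (hρ : 0 < ρ) (hc : 0 < c) :
    similarityParam σ k ρ c ^ 2 = σ ^ 2 / (k / (ρ * c)) := by
  rw [similarityParam, div_pow, Real.sq_sqrt (by positivity)]

theorem similarityParam_eq_iff (hσ : 0 < σ) (hk : 0 < k) (hρ : 0 < ρ) (hc : 0 < c)
    {ξ : ℝ} (hξ : 0 < ξ) :
    similarityParam σ k ρ c = ξ ↔ c = k * ξ ^ 2 / (σ ^ 2 * ρ) := by
  rw [← sq_eq_sq₀ (similarityParam_pos hσ hk hρ hc).le hξ.le, similarityParam_sq hk hρ hc,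
    div_div_eq_mul_div, div_eq_iff hk.ne', eq_div_iff (by positivity)]
  constructor <;> intro h <;> linarith

theorem eqE1_iff (hσ : 0 < σ) (hq : 0 < q₀) (hl : 0 < l) (hk : 0 < k) (hγ : 0 < γ)
    (hε : ε < 1) (hρ : 0 < ρ) (hc : 0 < c) :
    eqE1 q₀ σ l k ρ c γ ε ↔
      ρ = q₀ / (l * σ) * Real.exp (-similarityParam σ k ρ c ^ 2) /
        (1 + γ * k * (1 - ε) / (2 * q₀ * σ) * Real.exp (similarityParam σ k ρ c ^ 2)) := by
  have hδ : 0 < 1 - ε := sub_pos.2 hε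
  rw [eqE1, ← similarityParam_sq hk hρ hc, Real.exp_neg]
  have hE := Real.exp_pos (similarityParam σ k ρ c ^ 2)
  generalize Real.exp (similarityParam σ k ρ c ^ 2) = E at hE ⊢
  have hA : γ * k * (1 - ε) / (2 * q₀ * σ) = γ * k * (1 - ε) / (2 * q₀) / σ := by
    rw [div_div]
  have hB : 0 < γ * k * (1 - ε) / (2 * q₀) := by positivity
  rw [hA]
  generalize γ * k * (1 - ε) / (2 * q₀) = B at hB ⊢
  have hR : q₀ / (l * σ) * E⁻¹ / (1 + B / σ * E) = q₀ / (l * ((σ + B * E) * E)) := by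
    field_simp
  rw [hR, div_eq_iff (by positivity), eq_div_iff (by positivity)]
  constructor <;> intro h <;> linarith

theorem eqE2_iff (hσ : 0 < σ) (hq : 0 < q₀) (hk : 0 < k) (hρ : 0 < ρ) (hc : 0 < c) :
    eqE2 q₀ h₀ D σ k ρ c ↔
      erf (similarityParam σ k ρ c) / similarityParam σ k ρ c =
        k * D / (q₀ * σ * Real.sqrt π) * (1 - q₀ / (h₀ * D)) := by
  have hα : 0 < Real.sqrt (k / (ρ * c)) := by positivity
  rw [eqE2, Real.sqrt_mul (by positivity), div_eq_iff (similarityParam_pos hσ hk hρ hc).ne',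
    similarityParam]
  generalize Real.sqrt (k / (ρ * c)) = a at hα ⊢
  have hπ : 0 < Real.sqrt π := by positivity
  have : k * D / (q₀ * (a * Real.sqrt π)) * (1 - q₀ / (h₀ * D)) =
      k * D / (q₀ * σ * Real.sqrt π) * (1 - q₀ / (h₀ * D)) * (σ / a) := by
    generalize 1 - q₀ / (h₀ * D) = w
    field_simp
  rw [this]

theorem eqE1_and_eqE2_iff (hσ : 0 < σ) (hq : 0 < q₀) (hl : 0 < l) (hk : 0 < k) (hγ : 0 < γ)
    (hε : ε < 1) {ξ : ℝ} (hξ : 0 < ξ)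
    (hE : erf ξ / ξ = k * D / (q₀ * σ * Real.sqrt π) * (1 - q₀ / (h₀ * D)))
    (hρ : 0 < ρ) (hc : 0 < c) :
    (eqE1 q₀ σ l k ρ c γ ε ∧ eqE2 q₀ h₀ D σ k ρ c) ↔
      (ρ = q₀ / (l * σ) * Real.exp (-ξ ^ 2) /
             (1 + γ * k * (1 - ε) / (2 * q₀ * σ) * Real.exp (ξ ^ 2)) ∧
       c = k * l / (σ * q₀) *
             (1 + γ * k * (1 - ε) / (2 * q₀ * σ) * Real.exp (ξ ^ 2)) * ξ ^ 2 *
               Real.exp (ξ ^ 2)) := by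
  have hδ : 0 < 1 - ε := sub_pos.2 hε
  rw [eqE1_iff hσ hq hl hk hγ hε hρ hc, eqE2_iff hσ hq hk hρ hc, ← hE,
    erf_div_self_inj (similarityParam_pos hσ hk hρ hc) hξ, and_comm]
  have hρc : ρ = q₀ / (l * σ) * Real.exp (-ξ ^ 2) /
      (1 + γ * k * (1 - ε) / (2 * q₀ * σ) * Real.exp (ξ ^ 2)) →
      k * ξ ^ 2 / (σ ^ 2 * ρ) = k * l / (σ * q₀) *
        (1 + γ * k * (1 - ε) / (2 * q₀ * σ) * Real.exp (ξ ^ 2)) * ξ ^ 2 *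
          Real.exp (ξ ^ 2) := by
    intro h
    have hB : 0 < 1 + γ * k * (1 - ε) / (2 * q₀ * σ) * Real.exp (ξ ^ 2) := by positivity
    rw [h, Real.exp_neg]
    generalize 1 + γ * k * (1 - ε) / (2 * q₀ * σ) * Real.exp (ξ ^ 2) = B at hB ⊢
    field_simp
  constructor
  · rintro ⟨hx, h⟩
    rw [hx] at h
    exact ⟨h, hρc h ▸ (similarityParam_eq_iff hσ hk hρ hc hξ).1 hx⟩
  · rintro ⟨h, h'⟩
    have hx := (similarityParam_eq_iff hσ hk hρ hc hξ).2 (h'.trans (hρc h).symm)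
    exact ⟨hx, hx.symm ▸ h⟩

end

/-- Case 15 (determination of `ρ` and `c`): there exist `ρ > 0` and `c > 0` satisfying the
system (E1)–(E2) iff `0 < 1 − q₀/(h₀D∞) < 2q₀σ/(kD∞)` (restrictions (R2) and (R17)); in that
case the solution is unique and given by
`ρ = (q₀/(lσ))·exp(−ξ²)/(1 + (γk(1−ε)/(2q₀σ))·exp(ξ²))` and
`c = (kl/(σq₀))·[1 + (γk(1−ε)/(2q₀σ))·exp(ξ²)]·ξ²·exp(ξ²)`, where `ξ` is the unique positive
solution of `erf(ξ)/ξ = (kD∞/(q₀σ√π))(1 − q₀/(h₀D∞))`. -/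
theorem case15_rho_c (q₀ h₀ D σ k l γ ε : ℝ)
    (hq : 0 < q₀) (hh : 0 < h₀) (hD : 0 < D) (hσ : 0 < σ)
    (hk : 0 < k) (hl : 0 < l) (hγ : 0 < γ) (hε : ε ∈ Set.Ioo (0:ℝ) 1) :
    ((∃ ρ c : ℝ, 0 < ρ ∧ 0 < c ∧ eqE1 q₀ σ l k ρ c γ ε ∧ eqE2 q₀ h₀ D σ k ρ c)
      ↔ (0 < 1 - q₀ / (h₀ * D) ∧ 1 - q₀ / (h₀ * D) < 2 * q₀ * σ / (k * D))) ∧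
    ((0 < 1 - q₀ / (h₀ * D) ∧ 1 - q₀ / (h₀ * D) < 2 * q₀ * σ / (k * D)) →
      ∀ ξ : ℝ, 0 < ξ →
        erf ξ / ξ = k * D / (q₀ * σ * Real.sqrt π) * (1 - q₀ / (h₀ * D)) →
        ∀ ρ c : ℝ, 0 < ρ → 0 < c →
          ((eqE1 q₀ σ l k ρ c γ ε ∧ eqE2 q₀ h₀ D σ k ρ c) ↔
            (ρ = q₀ / (l * σ) * Real.exp (-ξ ^ 2) /
                   (1 + γ * k * (1 - ε) / (2 * q₀ * σ) * Real.exp (ξ ^ 2)) ∧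
             c = k * l / (σ * q₀) *
                   (1 + γ * k * (1 - ε) / (2 * q₀ * σ) * Real.exp (ξ ^ 2)) * ξ ^ 2 *
                     Real.exp (ξ ^ 2)))) := by
  have hδ : 0 < 1 - ε := sub_pos.2 hε.2
  refine ⟨?_, fun _ ξ hξ hE ρ c hρ hc => eqE1_and_eqE2_iff hσ hq hl hk hγ hε.2 hξ hE hρ hc⟩
  have hπ : 0 < Real.sqrt π := by positivity
  have hcond : (0 < 1 - q₀ / (h₀ * D) ∧ 1 - q₀ / (h₀ * D) < 2 * q₀ * σ / (k * D)) ↔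
      ∃ ξ, 0 < ξ ∧
        erf ξ / ξ = k * D / (q₀ * σ * Real.sqrt π) * (1 - q₀ / (h₀ * D)) := by
    have hK : 0 < k * D / (q₀ * σ * Real.sqrt π) := by positivity
    have hR : 2 * q₀ * σ / (k * D) =
        2 / Real.sqrt π / (k * D / (q₀ * σ * Real.sqrt π)) := by
      field_simp
    rw [exists_erf_div_self_eq_iff, mul_pos_iff_of_pos_left hK, hR, lt_div_iff₀' hK]
  rw [hcond]
  constructor
  · rintro ⟨ρ, c, hρ, hc, -, h2⟩
    exact ⟨similarityParam σ k ρ c, similarityParam_pos hσ hk hρ hc,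
      (eqE2_iff hσ hq hk hρ hc).1 h2⟩
  · rintro ⟨ξ, hξ, hE⟩
    refine ⟨_, _, ?_, ?_, (eqE1_and_eqE2_iff hσ hq hl hk hγ hε.2 hξ hE ?_ ?_).2 ⟨rfl, rfl⟩⟩ <;>
      positivity
end
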